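/- arXiv:2510.05546 — 14 statements merged into one kernel-verified Lean document; each statement's English description precedes it below -/
import Mathlib

section
/- Fix n ≥ 1 and real numbers α, β, c. Let R : Fin n → Fin n → Fin n → Fin n → ℂ and suppose the constant second mixed curvature condition C^{(2)}_{α,β} = c holds: for every X : Fin n → ℂ, (α:ℂ) * (∑_{i,j} Ric² i j * X i * conj (X j)) * ‖X‖² + (β:ℂ) * Q(X) = (c:ℂ) * (‖X‖²)². Then for all indices i, j, k, l: α * (Ric² i j * δ_{kl} + Ric² k j * δ_{il} + Ric² i l * δ_{kj} + Ric² k l * δ_{ij}) + β * (R i j k l + R k j i l + R i l k j + R k l i j) = 2c * (δ_{ij} * δ_{kl} + δ_{il} * δ_{kj}). -/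
open ComplexConjugate

/-- Kronecker delta. -/
noncomputable def kdelta {n : ℕ} (i j : Fin n) : ℂ := if i = j then 1 else 0

/-- `‖X‖² = ∑ᵢ Xᵢ conj(Xᵢ)` as a complex number. -/
noncomputable def normSqC {n : ℕ} (X : Fin n → ℂ) : ℂ := ∑ i, X i * conj (X i)

/-- The quartic form `Q(X) = ∑ R i j k l Xᵢ conj(Xⱼ) Xₖ conj(X_l)`. -/
noncomputable def Qform {n : ℕ} (R : Fin n → Fin n → Fin n → Fin n → ℂ) (X : Fin n → ℂ) : ℂ :=
  ∑ i, ∑ j, ∑ k, ∑ l, R i j k l * X i * conj (X j) * X k * conj (X l)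

/-- First Chern Ricci: `Ric¹ i j = ∑ₖ R i j k k`. -/
noncomputable def ric1 {n : ℕ} (R : Fin n → Fin n → Fin n → Fin n → ℂ) (i j : Fin n) : ℂ := ∑ k, R i j k k

/-- Second Chern Ricci: `Ric² k l = ∑ᵢ R i i k l`. -/
noncomputable def ric2 {n : ℕ} (R : Fin n → Fin n → Fin n → Fin n → ℂ) (k l : Fin n) : ℂ := ∑ i, R i i k l

/-- Third Chern Ricci: `Ric³ i l = ∑ₖ R i k k l`. -/
noncomputable def ric3 {n : ℕ} (R : Fin n → Fin n → Fin n → Fin n → ℂ) (i l : Fin n) : ℂ := ∑ k, R i k k l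

/-- Fourth Chern Ricci: `Ric⁴ k j = ∑ᵢ R i j k i`. -/
noncomputable def ric4 {n : ℕ} (R : Fin n → Fin n → Fin n → Fin n → ℂ) (k j : Fin n) : ℂ := ∑ i, R i j k i

/-- Chern scalar curvature `u = ∑ᵢₖ R i i k k`. -/
noncomputable def scalarU {n : ℕ} (R : Fin n → Fin n → Fin n → Fin n → ℂ) : ℂ := ∑ i, ∑ k, R i i k k

/-- Altered Chern scalar curvature `v = ∑ᵢₖ R i k k i`. -/
noncomputable def scalarV {n : ℕ} (R : Fin n → Fin n → Fin n → Fin n → ℂ) : ℂ := ∑ i, ∑ k, R i k k i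

/-- The sesquilinear form in four variables whose diagonal is `Qform`. -/
noncomputable def quarticForm {n : ℕ} (S : Fin n → Fin n → Fin n → Fin n → ℂ)
    (a b c d : Fin n → ℂ) : ℂ :=
  ∑ i, ∑ j, ∑ k, ∑ l, S i j k l * a i * conj (b j) * c k * conj (d l)

section quarticForm

variable {n : ℕ} (S : Fin n → Fin n → Fin n → Fin n → ℂ) (a a' b c d : Fin n → ℂ) (t : ℂ)

lemma quarticForm_add_smul₁ :
    quarticForm S (a + t • a') b c d = quarticForm S a b c d + t * quarticForm S a' b c d := by
  simp only [quarticForm, Finset.mul_sum, ← Finset.sum_add_distrib, Pi.add_apply, Pi.smul_apply,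
    smul_eq_mul]
  congr! 4
  ring

lemma quarticForm_add_smul₂ :
    quarticForm S b (a + t • a') c d =
      quarticForm S b a c d + conj t * quarticForm S b a' c d := by
  simp only [quarticForm, Finset.mul_sum, ← Finset.sum_add_distrib, Pi.add_apply, Pi.smul_apply,
    smul_eq_mul, map_add, map_mul]
  congr! 4
  ring

lemma quarticForm_add_smul₃ :
    quarticForm S b c (a + t • a') d = quarticForm S b c a d + t * quarticForm S b c a' d := by
  simp only [quarticForm, Finset.mul_sum, ← Finset.sum_add_distrib, Pi.add_apply, Pi.smul_apply,
    smul_eq_mul]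
  congr! 4
  ring

lemma quarticForm_add_smul₄ :
    quarticForm S b c d (a + t • a') =
      quarticForm S b c d a + conj t * quarticForm S b c d a' := by
  simp only [quarticForm, Finset.mul_sum, ← Finset.sum_add_distrib, Pi.add_apply, Pi.smul_apply,
    smul_eq_mul, map_add, map_mul]
  congr! 4
  ring

lemma quarticForm_single (i j k l : Fin n) :
    quarticForm S (Pi.single i 1) (Pi.single j 1) (Pi.single k 1) (Pi.single l 1) = S i j k l := by
  simp [quarticForm, Pi.single_apply, apply_ite conj]

end quarticForm

/-- Polarization in one variable, keeping the part that is complex linear in the increment. -/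
lemma quarticForm_add_swap_eq_zero {n : ℕ} {S : Fin n → Fin n → Fin n → Fin n → ℂ}
    (h : ∀ X, Qform S X = 0) (x y : Fin n → ℂ) :
    quarticForm S y x x x + quarticForm S x x y x = 0 := by
  have expand (t : ℂ) := h (x + t • y)
  change ∀ t : ℂ, quarticForm S (x + t • y) (x + t • y) (x + t • y) (x + t • y) = 0 at expand
  simp only [quarticForm_add_smul₁, quarticForm_add_smul₂, quarticForm_add_smul₃,
    quarticForm_add_smul₄] at expand
  have h₁ := expand 1
  have h₂ := expand (-1)
  have h₃ := expand Complex.I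
  have h₄ := expand (-Complex.I)
  have h₅ := expand 2
  have h₆ := expand (-2)
  have h₇ := expand (2 * Complex.I)
  have h₈ := expand (-(2 * Complex.I))
  simp only [map_one, map_neg, map_mul, Complex.conj_I, Complex.conj_ofNat]
    at h₁ h₂ h₃ h₄ h₅ h₆ h₇ h₈
  have hI := Complex.I_sq
  grind

lemma quarticForm_polarization {n : ℕ} {S : Fin n → Fin n → Fin n → Fin n → ℂ}
    (h : ∀ X, Qform S X = 0) (x y z w : Fin n → ℂ) :
    quarticForm S y x z w + quarticForm S z x y w + quarticForm S y w z x
      + quarticForm S z w y x = 0 := by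
  have diag (x : Fin n → ℂ) : quarticForm S y x z x + quarticForm S z x y x = 0 := by
    have expand (t : ℂ) := quarticForm_add_swap_eq_zero h (x + t • z) y
    simp only [quarticForm_add_smul₁, quarticForm_add_smul₂, quarticForm_add_smul₃,
      quarticForm_add_smul₄] at expand
    have h₁ := expand 1
    have h₂ := expand (-1)
    have h₃ := expand Complex.I
    have h₄ := expand (-Complex.I)
    simp only [map_one, map_neg, Complex.conj_I] at h₁ h₂ h₃ h₄
    have hI := Complex.I_sq
    grind
  have sum := diag (x + (1 : ℂ) • w)
  simp only [quarticForm_add_smul₂, quarticForm_add_smul₄, map_one] at sum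
  linear_combination sum - diag x - diag w

/-- A tensor with vanishing quartic form has vanishing symmetrization. -/
lemma symmetrization_eq_zero_of_Qform_eq_zero {n : ℕ} {S : Fin n → Fin n → Fin n → Fin n → ℂ}
    (h : ∀ X, Qform S X = 0) (i j k l : Fin n) :
    S i j k l + S k j i l + S i l k j + S k l i j = 0 := by
  simpa only [quarticForm_single] using quarticForm_polarization h
    (Pi.single j 1) (Pi.single i 1) (Pi.single k 1) (Pi.single l 1)

lemma Qform_mul_kdelta {n : ℕ} (A : Fin n → Fin n → ℂ) (X : Fin n → ℂ) :
    Qform (fun i j k l => A i j * kdelta k l) X =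
      (∑ i, ∑ j, A i j * X i * conj (X j)) * normSqC X := by
  simp only [Qform, normSqC, kdelta, Finset.sum_mul]
  congr! 2
  rw [Finset.mul_sum]
  congr! 1
  simp [mul_assoc, mul_left_comm, mul_comm]

/-- Equation (3.18): pointwise consequence of constant second mixed curvature. -/
theorem constant_mixed2_tensor_identity (n : ℕ) (hn : 1 ≤ n) (α β c : ℝ)
    (R : Fin n → Fin n → Fin n → Fin n → ℂ)
    (h : ∀ X : Fin n → ℂ,
      (α : ℂ) * (∑ i, ∑ j, ric2 R i j * X i * conj (X j)) * normSqC X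
        + (β : ℂ) * Qform R X = (c : ℂ) * (normSqC X) ^ 2) :
    ∀ i j k l : Fin n,
      (α : ℂ) * (ric2 R i j * kdelta k l + ric2 R k j * kdelta i l
          + ric2 R i l * kdelta k j + ric2 R k l * kdelta i j)
        + (β : ℂ) * (R i j k l + R k j i l + R i l k j + R k l i j)
        = 2 * (c : ℂ) * (kdelta i j * kdelta k l + kdelta i l * kdelta k j) := by
  intro i j k l
  have hQ (X : Fin n → ℂ) : Qform (fun i j k l => (α : ℂ) * (ric2 R i j * kdelta k l)
      + β * R i j k l - c * (kdelta i j * kdelta k l)) X = 0 := by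
    have hsplit : Qform (fun i j k l => (α : ℂ) * (ric2 R i j * kdelta k l)
        + β * R i j k l - c * (kdelta i j * kdelta k l)) X =
        α * Qform (fun i j k l => ric2 R i j * kdelta k l) X + β * Qform R X
          - c * Qform (fun i j k l => kdelta i j * kdelta k l) X := by
      simp only [Qform, Finset.mul_sum, ← Finset.sum_add_distrib, ← Finset.sum_sub_distrib]
      congr! 4
      ring
    have hnorm : ∑ i, ∑ j, kdelta i j * X i * conj (X j) = normSqC X := by
      simp [kdelta, normSqC]
    rw [hsplit, Qform_mul_kdelta, Qform_mul_kdelta, hnorm]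
    linear_combination h X
  have hcomm (a b : Fin n) : kdelta a b = kdelta b a := by simp [kdelta, eq_comm]
  linear_combination symmetrization_eq_zero_of_Qform_eq_zero hQ i j k l
end

section
/- Let R : Fin 2 → Fin 2 → Fin 2 → Fin 2 → ℂ be any 4-index tensor on ℂ². Then for all indices i, j: Ric¹ i j + Ric² i j − Ric³ i j − Ric⁴ i j = (u − v) * δ_{ij}. -/
open ComplexConjugate

/-- Dimension-two identity `ρ⁽¹⁾ + ρ⁽²⁾ − ρ⁽³⁾ − ρ⁽⁴⁾ = (u − v) g` for any 4-tensor. -/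
theorem dim_two_ricci_identity (R : Fin 2 → Fin 2 → Fin 2 → Fin 2 → ℂ) :
    ∀ i j : Fin 2,
      ric1 R i j + ric2 R i j - ric3 R i j - ric4 R i j
        = (scalarU R - scalarV R) * kdelta i j := by
  intro i j
  fin_cases i <;> fin_cases j <;>
    simp [ric1, ric2, ric3, ric4, scalarU, scalarV, kdelta, Fin.sum_univ_two] <;> ring
end

section
/- Fix real numbers α, β, c and let R : Fin 2 → Fin 2 → Fin 2 → Fin 2 → ℂ satisfy the constant second mixed curvature condition C^{(2)}_{α,β} = c: for every X : Fin 2 → ℂ, (α:ℂ) * (∑_{i,j} Ric² i j * X i * conj (X j)) * ‖X‖² + (β:ℂ) * Q(X) = (c:ℂ) * (‖X‖²)². Then (3α + 2β)*(R 1 1 1 1 + R 2 2 2 2) + (3α + β)*(R 1 1 2 2 + R 2 2 1 1) + β*(R 1 2 2 1 + R 2 1 1 2) = 6c. -/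
open ComplexConjugate

/-- Equation (3.1): averaged identity for constant second mixed curvature on a surface.
Paper indices 1,2 correspond to `0,1 : Fin 2`. -/
theorem constant_mixed2_averaged_surface (α β c : ℝ)
    (R : Fin 2 → Fin 2 → Fin 2 → Fin 2 → ℂ)
    (h : ∀ X : Fin 2 → ℂ,
      (α : ℂ) * (∑ i, ∑ j, ric2 R i j * X i * conj (X j)) * normSqC X
        + (β : ℂ) * Qform R X = (c : ℂ) * (normSqC X) ^ 2) :
    ((3 * α + 2 * β : ℝ) : ℂ) * (R 0 0 0 0 + R 1 1 1 1)
      + ((3 * α + β : ℝ) : ℂ) * (R 0 0 1 1 + R 1 1 0 0)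
      + (β : ℂ) * (R 0 1 1 0 + R 1 0 0 1) = ((6 * c : ℝ) : ℂ) := by
  have h₁ := h ![1, 0]
  have h₂ := h ![0, 1]
  have h₃ := h ![1, 1]
  have h₄ := h ![1, -1]
  have h₅ := h ![1, Complex.I]
  have h₆ := h ![1, -Complex.I]
  simp only [Qform, normSqC, ric2, Fin.sum_univ_two, Matrix.cons_val_zero, Matrix.cons_val_one,
    map_one, map_zero, map_neg, Complex.conj_I] at h₁ h₂ h₃ h₄ h₅ h₆
  push_cast
  ring_nf at h₅ h₆
  simp only [Complex.I_sq, Complex.I_pow_three, Complex.I_pow_four] at h₅ h₆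
  linear_combination h₁ + h₂ + (h₃ + h₄ + h₅ + h₆) / 4
end

section
/- Fix real numbers α, β, c with β ≠ 0, and let R : Fin 2 → Fin 2 → Fin 2 → Fin 2 → ℂ satisfy the constant second mixed curvature condition C^{(2)}_{α,β} = c: for every X : Fin 2 → ℂ, (α:ℂ) * (∑_{i,j} Ric² i j * X i * conj (X j)) * ‖X‖² + (β:ℂ) * Q(X) = (c:ℂ) * (‖X‖²)². Then R 1 1 1 1 + R 2 2 2 2 = R 1 1 2 2 + R 2 2 1 1 + R 1 2 2 1 + R 2 1 1 2. -/
open ComplexConjugate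

/-- Equation (3.4): vanishing of `W₃⁻` for constant second mixed curvature.
Paper indices 1,2 correspond to `0,1 : Fin 2`. -/
theorem constant_mixed2_W3_vanishes (α β c : ℝ) (hβ : β ≠ 0)
    (R : Fin 2 → Fin 2 → Fin 2 → Fin 2 → ℂ)
    (h : ∀ X : Fin 2 → ℂ,
      (α : ℂ) * (∑ i, ∑ j, ric2 R i j * X i * conj (X j)) * normSqC X
        + (β : ℂ) * Qform R X = (c : ℂ) * (normSqC X) ^ 2) :
    R 0 0 0 0 + R 1 1 1 1
      = R 0 0 1 1 + R 1 1 0 0 + R 0 1 1 0 + R 1 0 0 1 := by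
  have hβ' : (β : ℂ) ≠ 0 := by exact_mod_cast hβ
  have e₁ := h ![1, 0]
  have e₂ := h ![0, 1]
  -- averaging over the phases of the second coordinate kills the off-diagonal terms
  have p₁ := h ![1, 1]
  have p₂ := h ![1, -1]
  have p₃ := h ![1, Complex.I]
  have p₄ := h ![1, -Complex.I]
  simp only [normSqC, Qform, Fin.sum_univ_two, Matrix.cons_val_zero, Matrix.cons_val_one,
    map_one, map_zero, map_neg, Complex.conj_I] at e₁ e₂ p₁ p₂ p₃ p₄
  have hI : Complex.I * Complex.I = -1 := Complex.I_mul_I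
  generalize Complex.I = I at hI p₃ p₄
  apply mul_left_cancel₀ hβ'
  linear_combination 2 * e₁ + 2 * e₂ - (p₁ + p₂ + p₃ + p₄) / 4
    + (α * (-ric2 R 0 0 + ric2 R 1 1 * (I * I - 2))
      + β * (R 1 1 1 1 * (I * I - 1)
        - (R 0 0 1 1 + R 1 1 0 0 + R 0 1 1 0 + R 1 0 0 1) + R 0 1 0 1 + R 1 0 1 0)
      - c * (I * I - 3)) / 2 * hI
end

section
/- Fix real numbers α, β, c and let R : Fin 2 → Fin 2 → Fin 2 → Fin 2 → ℂ satisfy the constant third mixed curvature condition C^{(3)}_{α,β} = c: for every X : Fin 2 → ℂ, (α:ℂ) * (∑_{i,j} Ric³ i j * X i * conj (X j)) * ‖X‖² + (β:ℂ) * Q(X) = (c:ℂ) * (‖X‖²)². Then (3α + 2β)*(R 1 1 1 1 + R 2 2 2 2) + (3α + β)*(R 1 2 2 1 + R 2 1 1 2) + β*(R 1 1 2 2 + R 2 2 1 1) = 6c. -/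
open ComplexConjugate

/-- Equation (3.5): averaged identity for constant third mixed curvature on a surface.
Paper indices 1,2 correspond to `0,1 : Fin 2`. -/
theorem constant_mixed3_averaged_surface (α β c : ℝ)
    (R : Fin 2 → Fin 2 → Fin 2 → Fin 2 → ℂ)
    (h : ∀ X : Fin 2 → ℂ,
      (α : ℂ) * (∑ i, ∑ j, ric3 R i j * X i * conj (X j)) * normSqC X
        + (β : ℂ) * Qform R X = (c : ℂ) * (normSqC X) ^ 2) :
    ((3 * α + 2 * β : ℝ) : ℂ) * (R 0 0 0 0 + R 1 1 1 1)
      + ((3 * α + β : ℝ) : ℂ) * (R 0 1 1 0 + R 1 0 0 1)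
      + (β : ℂ) * (R 0 0 1 1 + R 1 1 0 0) = ((6 * c : ℝ) : ℂ) := by
  have h₁ := h ![1, 0]
  have h₂ := h ![0, 1]
  have h₃ := h ![1, 1]
  have h₄ := h ![1, -1]
  have h₅ := h ![1, Complex.I]
  have h₆ := h ![1, -Complex.I]
  simp only [normSqC, Qform, ric3, Fin.sum_univ_two, Matrix.cons_val_zero, Matrix.cons_val_one,
    map_one, map_zero, map_neg, Complex.conj_I] at h₁ h₂ h₃ h₄ h₅ h₆
  push_cast
  linear_combination (norm := skip) h₁ + h₂ + (h₃ + h₄ + h₅ + h₆) / 4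
  ring_nf
  simp only [Complex.I_sq, Complex.I_pow_four]
  ring
end

section
/- Fix real numbers α, β, c with β ≠ 0, and let R : Fin 2 → Fin 2 → Fin 2 → Fin 2 → ℂ satisfy the constant third mixed curvature condition C^{(3)}_{α,β} = c: for every X : Fin 2 → ℂ, (α:ℂ) * (∑_{i,j} Ric³ i j * X i * conj (X j)) * ‖X‖² + (β:ℂ) * Q(X) = (c:ℂ) * (‖X‖²)². Then R 1 1 1 1 + R 2 2 2 2 = R 1 1 2 2 + R 2 2 1 1 + R 1 2 2 1 + R 2 1 1 2. -/
open ComplexConjugate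

/-- Equation (3.8): vanishing of `W₃⁻` for constant third mixed curvature.
Paper indices 1,2 correspond to `0,1 : Fin 2`. -/
theorem constant_mixed3_W3_vanishes (α β c : ℝ) (hβ : β ≠ 0)
    (R : Fin 2 → Fin 2 → Fin 2 → Fin 2 → ℂ)
    (h : ∀ X : Fin 2 → ℂ,
      (α : ℂ) * (∑ i, ∑ j, ric3 R i j * X i * conj (X j)) * normSqC X
        + (β : ℂ) * Qform R X = (c : ℂ) * (normSqC X) ^ 2) :
    R 0 0 0 0 + R 1 1 1 1
      = R 0 0 1 1 + R 1 1 0 0 + R 0 1 1 0 + R 1 0 0 1 := by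
  have hβ' : (β : ℂ) ≠ 0 := Complex.ofReal_ne_zero.mpr hβ
  have e₀ := h ![1, 0]
  have e₁ := h ![0, 1]
  have p₀ := h ![1, 1]
  have p₁ := h ![1, Complex.I]
  have p₂ := h ![1, -1]
  have p₃ := h ![1, -Complex.I]
  simp [normSqC, Qform, Fin.sum_univ_two, mul_assoc] at e₀ e₁ p₀ p₁ p₂ p₃
  apply mul_left_cancel₀ hβ'
  -- Averaging over the fourth roots of unity isolates the torus-invariant coefficients.
  linear_combination 2 * e₀ + 2 * e₁ - (p₀ + p₁ + p₂ + p₃) / 4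
end

section
/- Fix real numbers α, β, c with β ≠ 0, and let R : Fin 2 → Fin 2 → Fin 2 → Fin 2 → ℂ satisfy the Hermitian symmetry R i j k l = conj (R j i l k) and the constant second mixed curvature condition C^{(2)}_{α,β} = c: for every X : Fin 2 → ℂ, (α:ℂ) * (∑_{i,j} Ric² i j * X i * conj (X j)) * ‖X‖² + (β:ℂ) * Q(X) = (c:ℂ) * (‖X‖²)². Then R 1 2 1 2 = 0 and R 2 1 2 1 = 0. -/
open ComplexConjugate

/-- The alternating sum of the quartic form over the vectors `(1, iᵏz)` isolates the two components
of weight `±2` under rotation of the second coordinate. -/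
theorem alternating_sum_Qform (R : Fin 2 → Fin 2 → Fin 2 → Fin 2 → ℂ) (z : ℂ) :
    Qform R ![1, z] - Qform R ![1, Complex.I * z] + Qform R ![1, -z]
      - Qform R ![1, -(Complex.I * z)] = 4 * (R 1 0 1 0 * z ^ 2 + R 0 1 0 1 * conj z ^ 2) := by
  simp only [Qform, Fin.sum_univ_two, Matrix.cons_val_zero, Matrix.cons_val_one, map_one, map_mul,
    map_neg, Complex.conj_I]
  linear_combination (-2 * (R 1 0 1 0 * z ^ 2 + R 0 1 0 1 * conj z ^ 2)
    + 2 * (R 0 0 1 1 + R 0 1 1 0 + R 1 0 0 1 + R 1 1 0 0) * z * conj z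
    + 2 * (1 - Complex.I ^ 2) * R 1 1 1 1 * z ^ 2 * conj z ^ 2) * Complex.I_sq

/-- The alternating sum of a sesquilinear form over the vectors `(1, iᵏz)` vanishes. -/
theorem alternating_sum_form (S : Fin 2 → Fin 2 → ℂ) (z : ℂ) :
    let F := fun X : Fin 2 → ℂ => ∑ i, ∑ j, S i j * X i * conj (X j)
    F ![1, z] - F ![1, Complex.I * z] + F ![1, -z] - F ![1, -(Complex.I * z)] = 0 := by
  simp only [Fin.sum_univ_two, Matrix.cons_val_zero, Matrix.cons_val_one, map_one,
    map_mul, map_neg, Complex.conj_I]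
  linear_combination 2 * S 1 1 * z * conj z * Complex.I_sq

/-- Vanishing of `W₁⁻ = R_{1̄21̄2}` for constant second mixed curvature.
Paper indices 1,2 correspond to `0,1 : Fin 2`. -/
theorem constant_mixed2_W1_vanishes (α β c : ℝ) (hβ : β ≠ 0)
    (R : Fin 2 → Fin 2 → Fin 2 → Fin 2 → ℂ)
    (hherm : ∀ i j k l : Fin 2, R i j k l = conj (R j i l k))
    (h : ∀ X : Fin 2 → ℂ,
      (α : ℂ) * (∑ i, ∑ j, ric2 R i j * X i * conj (X j)) * normSqC X
        + (β : ℂ) * Qform R X = (c : ℂ) * (normSqC X) ^ 2) :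
    R 0 1 0 1 = 0 ∧ R 1 0 1 0 = 0 := by
  have hnorm (z : ℂ) : normSqC ![1, Complex.I * z] = normSqC ![1, z] ∧
      normSqC ![1, -z] = normSqC ![1, z] ∧
      normSqC ![1, -(Complex.I * z)] = normSqC ![1, z] := by
    have hI : Complex.I * z * (-Complex.I * conj z) = z * conj z := by
      linear_combination -z * conj z * Complex.I_sq
    simp [normSqC, Fin.sum_univ_two, ← hI]
  have key (z : ℂ) : R 1 0 1 0 * z ^ 2 + R 0 1 0 1 * conj z ^ 2 = 0 := by
    obtain ⟨h1, h2, h3⟩ := hnorm z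
    have e0 := h ![1, z]
    have e1 := h ![1, Complex.I * z]
    have e2 := h ![1, -z]
    have e3 := h ![1, -(Complex.I * z)]
    rw [h1] at e1
    rw [h2] at e2
    rw [h3] at e3
    have hF := alternating_sum_form (ric2 R) z
    have hQ := alternating_sum_Qform R z
    refine (mul_eq_zero.mp ?_).resolve_left (mul_ne_zero (Complex.ofReal_ne_zero.mpr hβ)
      (by norm_num : (4 : ℂ) ≠ 0))
    linear_combination e0 - e1 + e2 - e3 - (β : ℂ) * hQ - (α : ℂ) * normSqC ![1, z] * hF
  have hone := key 1
  have hdiag := key (1 + Complex.I)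
  simp only [map_add, map_one, Complex.conj_I] at hone hdiag
  have hsub : R 1 0 1 0 - R 0 1 0 1 = 0 := by
    refine (mul_eq_zero.mp ?_).resolve_left (mul_ne_zero two_ne_zero Complex.I_ne_zero)
    linear_combination hdiag - (R 1 0 1 0 + R 0 1 0 1) * Complex.I_sq
  constructor
  · linear_combination (hone - hsub) / 2
  · linear_combination (hone + hsub) / 2
end

section
/- Fix real numbers α, β, c with β ≠ 0, and let R : Fin 2 → Fin 2 → Fin 2 → Fin 2 → ℂ satisfy the Hermitian symmetry R i j k l = conj (R j i l k) and the constant second mixed curvature condition C^{(2)}_{α,β} = c: for every X : Fin 2 → ℂ, (α:ℂ) * (∑_{i,j} Ric² i j * X i * conj (X j)) * ‖X‖² + (β:ℂ) * Q(X) = (c:ℂ) * (‖X‖²)². Then R 1 2 2 2 + R 2 2 1 2 − R 1 2 1 1 − R 1 1 1 2 = 0. -/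
open ComplexConjugate

/-- Vanishing of `W₂⁻` for constant second mixed curvature.
Paper indices 1,2 correspond to `0,1 : Fin 2`. -/
theorem constant_mixed2_W2_vanishes (α β c : ℝ) (hβ : β ≠ 0)
    (R : Fin 2 → Fin 2 → Fin 2 → Fin 2 → ℂ)
    (hherm : ∀ i j k l : Fin 2, R i j k l = conj (R j i l k))
    (h : ∀ X : Fin 2 → ℂ,
      (α : ℂ) * (∑ i, ∑ j, ric2 R i j * X i * conj (X j)) * normSqC X
        + (β : ℂ) * Qform R X = (c : ℂ) * (normSqC X) ^ 2) :
    R 0 1 1 1 + R 1 1 0 1 - R 0 1 0 0 - R 0 0 0 1 = 0 := by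
  -- The part of the identity odd in `X 1` is `A·x₀x̄₁|x₀|² + B·x₀x̄₁|x₁|²` plus the terms in
  -- `x̄₀x₁`; eight sample points determine `B - A`, which is `β` times the goal.
  have h₁ := h ![1, 1]
  have h₂ := h ![1, -1]
  have h₃ := h ![1, Complex.I]
  have h₄ := h ![1, -Complex.I]
  have h₅ := h ![2, 1]
  have h₆ := h ![2, -1]
  have h₇ := h ![2, Complex.I]
  have h₈ := h ![2, -Complex.I]
  simp only [ric2, normSqC, Qform, Fin.sum_univ_two, Matrix.cons_val_zero, Matrix.cons_val_one,
    map_one, map_neg, map_ofNat, Complex.conj_I] at h₁ h₂ h₃ h₄ h₅ h₆ h₇ h₈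
  have hβ' : (β : ℂ) ≠ 0 := Complex.ofReal_ne_zero.mpr hβ
  apply mul_left_cancel₀ hβ'
  have hI : Complex.I ^ 2 = -1 := Complex.I_sq
  have hI3 : Complex.I ^ 3 = -Complex.I := by rw [pow_succ, hI]; ring
  have hI4 : Complex.I ^ 4 = 1 := Complex.I_pow_four
  ring_nf at h₃ h₄ h₇ h₈
  simp only [hI, hI3, hI4] at h₃ h₄ h₇ h₈
  linear_combination (5 / 12) * (h₁ - h₂) + (5 / 12) * Complex.I * (h₃ - h₄)
    - (1 / 12) * (h₅ - h₆) - (1 / 12) * Complex.I * (h₇ - h₈)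
    + (1 / 2) * β * (R 0 1 1 1 + R 1 1 0 1 - R 0 1 0 0 - R 0 0 0 1
      + R 1 0 0 0 + R 0 0 1 0 - R 1 0 1 1 - R 1 1 1 0) * hI
end

section
/- Fix real numbers α, β, c with β ≠ 0, and let R : Fin 2 → Fin 2 → Fin 2 → Fin 2 → ℂ satisfy the Hermitian symmetry R i j k l = conj (R j i l k) and the constant first mixed curvature condition C^{(1)}_{α,β} = c: for every X : Fin 2 → ℂ, (α:ℂ) * (∑_{i,j} Ric¹ i j * X i * conj (X j)) * ‖X‖² + (β:ℂ) * Q(X) = (c:ℂ) * (‖X‖²)². Then (i) R 1 2 1 2 = 0; (ii) R 1 2 2 2 + R 2 2 1 2 − R 1 2 1 1 − R 1 1 1 2 = 0; and (iii) R 1 1 1 1 + R 2 2 2 2 − R 1 1 2 2 − R 2 2 1 1 − R 1 2 2 1 − R 2 1 1 2 = 0. -/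
open ComplexConjugate

/-- A polynomial in `z` and `conj z` of bidegree at most `(2, 2)` that vanishes identically on `ℂ`
has zero coefficients `conj z ^ 2`, `conj z`, `z * conj z ^ 2`, `1`, `z * conj z`,
`z ^ 2 * conj z ^ 2`. -/
theorem bidegree_two_coeff_eq_zero {a00 a10 a01 a20 a11 a02 a21 a12 a22 : ℂ}
    (h : ∀ z : ℂ, a00 + a10 * z + a01 * conj z + a20 * z ^ 2 + a11 * (z * conj z)
      + a02 * conj z ^ 2 + a21 * (z ^ 2 * conj z) + a12 * (z * conj z ^ 2)
      + a22 * (z * conj z) ^ 2 = 0) :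
    a02 = 0 ∧ a01 = 0 ∧ a12 = 0 ∧ a00 = 0 ∧ a11 = 0 ∧ a22 = 0 := by
  have hI : Complex.I ^ 2 = -1 := Complex.I_sq
  have h0 : a00 = 0 := by simpa using h 0
  have h1 := h 1
  have h2 := h (-1)
  have h3 := h Complex.I
  have h4 := h (-Complex.I)
  have h5 := h 2
  have h6 := h (-2)
  have h7 := h (2 * Complex.I)
  have h8 := h (-(2 * Complex.I))
  have h9 := h (1 + Complex.I)
  have h10 := h (-(1 + Complex.I))
  simp only [map_neg, map_mul, map_add, map_one, map_ofNat, Complex.conj_I]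
    at h1 h2 h3 h4 h5 h6 h7 h8 h9 h10
  generalize Complex.I = I at *
  grind

/-- Theorem 1.1 for k = first: a surface with constant first-th mixed curvature is self-dual,
i.e. W₁⁻ = W₂⁻ = W₃⁻ = 0. Paper indices 1,2 correspond to `0,1 : Fin 2`. -/
theorem constant_mixed1_selfdual (α β c : ℝ) (hβ : β ≠ 0)
    (R : Fin 2 → Fin 2 → Fin 2 → Fin 2 → ℂ)
    (hherm : ∀ i j k l : Fin 2, R i j k l = conj (R j i l k))
    (h : ∀ X : Fin 2 → ℂ,
      (α : ℂ) * (∑ i, ∑ j, ric1 R i j * X i * conj (X j)) * normSqC X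
        + (β : ℂ) * Qform R X = (c : ℂ) * (normSqC X) ^ 2) :
    R 0 1 0 1 = 0
      ∧ R 0 1 1 1 + R 1 1 0 1 - R 0 1 0 0 - R 0 0 0 1 = 0
      ∧ R 0 0 0 0 + R 1 1 1 1 - R 0 0 1 1 - R 1 1 0 0 - R 0 1 1 0 - R 1 0 0 1 = 0 := by
  have key := bidegree_two_coeff_eq_zero
    (a00 := α * ric1 R 0 0 + β * R 0 0 0 0 - c)
    (a10 := α * ric1 R 1 0 + β * (R 1 0 0 0 + R 0 0 1 0))
    (a01 := α * ric1 R 0 1 + β * (R 0 1 0 0 + R 0 0 0 1))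
    (a20 := β * R 1 0 1 0)
    (a11 := α * (ric1 R 0 0 + ric1 R 1 1)
      + β * (R 0 0 1 1 + R 1 1 0 0 + R 0 1 1 0 + R 1 0 0 1) - 2 * c)
    (a02 := β * R 0 1 0 1)
    (a21 := α * ric1 R 1 0 + β * (R 1 0 1 1 + R 1 1 1 0))
    (a12 := α * ric1 R 0 1 + β * (R 0 1 1 1 + R 1 1 0 1))
    (a22 := α * ric1 R 1 1 + β * R 1 1 1 1 - c)
    (fun z => by
      have hz := h ![1, z]
      simp only [normSqC, Qform, Fin.sum_univ_two, Matrix.cons_val_zero, Matrix.cons_val_one,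
        map_one] at hz
      linear_combination hz)
  obtain ⟨h02, h01, h12, h00, h11, h22⟩ := key
  have hβ' : (β : ℂ) ≠ 0 := Complex.ofReal_ne_zero.mpr hβ
  refine ⟨?_, ?_, ?_⟩ <;> apply mul_left_cancel₀ hβ'
  · linear_combination h02
  · linear_combination h12 - h01
  · linear_combination h00 + h22 - h11
end

section
/- Fix real numbers α, β, c with β ≠ 0, and let R : Fin 2 → Fin 2 → Fin 2 → Fin 2 → ℂ satisfy the Hermitian symmetry R i j k l = conj (R j i l k) and the constant third mixed curvature condition C^{(3)}_{α,β} = c: for every X : Fin 2 → ℂ, (α:ℂ) * (∑_{i,j} Ric³ i j * X i * conj (X j)) * ‖X‖² + (β:ℂ) * Q(X) = (c:ℂ) * (‖X‖²)². Then (i) R 1 2 1 2 = 0; (ii) R 1 2 2 2 + R 2 2 1 2 − R 1 2 1 1 − R 1 1 1 2 = 0; and (iii) R 1 1 1 1 + R 2 2 2 2 − R 1 1 2 2 − R 2 2 1 1 − R 1 2 2 1 − R 2 1 1 2 = 0. -/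
open ComplexConjugate

/-- A polynomial in `u` and `conj u` of degree at most two in each variable that vanishes on `ℂ`
has vanishing coefficients; `pab` is the coefficient of `u ^ a * conj u ^ b`, and the remaining
coefficients `p10`, `p20`, `p21` are covered by replacing `u` with `conj u`. -/
lemma coeff_eq_zero_of_biquadratic (p00 p10 p01 p20 p11 p02 p21 p12 p22 : ℂ)
    (h : ∀ u : ℂ, p00 + p10 * u + p01 * conj u + p20 * u ^ 2 + p11 * (u * conj u)
      + p02 * conj u ^ 2 + p21 * (u ^ 2 * conj u) + p12 * (u * conj u ^ 2)
      + p22 * (u ^ 2 * conj u ^ 2) = 0) :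
    p00 = 0 ∧ p01 = 0 ∧ p11 = 0 ∧ p02 = 0 ∧ p12 = 0 ∧ p22 = 0 := by
  have on_ray : ∀ v : ℂ, p00 = 0 ∧ p10 * v + p01 * conj v = 0 ∧
      p20 * v ^ 2 + p11 * (v * conj v) + p02 * conj v ^ 2 = 0 ∧
      p21 * (v ^ 2 * conj v) + p12 * (v * conj v ^ 2) = 0 ∧
      p22 * (v ^ 2 * conj v ^ 2) = 0 := by
    intro v
    have h0 := h 0
    have h1 := h v
    have h2 := h (-v)
    have h3 := h (2 * v)
    have h4 := h (-(2 * v))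
    simp only [map_zero, map_neg, map_mul, Complex.conj_ofNat] at h0 h1 h2 h3 h4
    refine ⟨?_, ?_, ?_, ?_, ?_⟩
    · linear_combination h0
    · linear_combination (2 / 3) * (h1 - h2) - (1 / 12) * (h3 - h4)
    · linear_combination (-5 / 4) * h0 + (2 / 3) * (h1 + h2) - (1 / 24) * (h3 + h4)
    · linear_combination (-1 / 6) * (h1 - h2) + (1 / 12) * (h3 - h4)
    · linear_combination (1 / 4) * h0 - (1 / 6) * (h1 + h2) + (1 / 24) * (h3 + h4)
  obtain ⟨h00, a1, a2, a3, a4⟩ := on_ray 1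
  obtain ⟨-, b1, b2, b3, -⟩ := on_ray Complex.I
  obtain ⟨-, -, c2, -, -⟩ := on_ray (1 + Complex.I)
  have hI := Complex.I_sq
  simp only [map_one, map_add, Complex.conj_I] at a1 a2 a3 a4 b1 b2 b3 c2
  have h11 : p11 = 0 := by
    linear_combination (1 / 2) * (a2 + b2) - (1 / 2) * (p20 - p11 + p02) * hI
  refine ⟨h00, ?_, h11, ?_, ?_, ?_⟩
  · linear_combination (1 / 2) * a1 + (Complex.I / 2) * b1 - (1 / 2) * (p10 - p01) * hI
  · linear_combination (1 / 2) * a2 + (Complex.I / 4) * c2 - (1 / 2) * h11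
      - (Complex.I / 2) * h11 - (1 / 2) * (p20 - p02) * hI
      - (Complex.I / 4) * (p20 - p11 + p02) * hI
  · linear_combination (1 / 2) * a3 + (Complex.I / 2) * b3
      - (1 / 2) * (p12 - p21) * (Complex.I ^ 2 - 1) * hI
  · linear_combination a4

/-- Theorem 1.1 for k = third: a surface with constant third-th mixed curvature is self-dual,
i.e. W₁⁻ = W₂⁻ = W₃⁻ = 0. Paper indices 1,2 correspond to `0,1 : Fin 2`. -/
theorem constant_mixed3_selfdual (α β c : ℝ) (hβ : β ≠ 0)
    (R : Fin 2 → Fin 2 → Fin 2 → Fin 2 → ℂ)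
    (hherm : ∀ i j k l : Fin 2, R i j k l = conj (R j i l k))
    (h : ∀ X : Fin 2 → ℂ,
      (α : ℂ) * (∑ i, ∑ j, ric3 R i j * X i * conj (X j)) * normSqC X
        + (β : ℂ) * Qform R X = (c : ℂ) * (normSqC X) ^ 2) :
    R 0 1 0 1 = 0
      ∧ R 0 1 1 1 + R 1 1 0 1 - R 0 1 0 0 - R 0 0 0 1 = 0
      ∧ R 0 0 0 0 + R 1 1 1 1 - R 0 0 1 1 - R 1 1 0 0 - R 0 1 1 0 - R 1 0 0 1 = 0 := by
  have hβ' : (β : ℂ) ≠ 0 := by exact_mod_cast hβ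
  obtain ⟨h00, h01, h11, h02, h12, h22⟩ := coeff_eq_zero_of_biquadratic
    (α * ric3 R 0 0 + β * R 0 0 0 0 - c)
    (α * ric3 R 1 0 + β * (R 1 0 0 0 + R 0 0 1 0))
    (α * ric3 R 0 1 + β * (R 0 1 0 0 + R 0 0 0 1))
    (β * R 1 0 1 0)
    (α * (ric3 R 0 0 + ric3 R 1 1)
      + β * (R 0 0 1 1 + R 1 1 0 0 + R 0 1 1 0 + R 1 0 0 1) - 2 * c)
    (β * R 0 1 0 1)
    (α * ric3 R 1 0 + β * (R 1 0 1 1 + R 1 1 1 0))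
    (α * ric3 R 0 1 + β * (R 0 1 1 1 + R 1 1 0 1))
    (α * ric3 R 1 1 + β * R 1 1 1 1 - c)
    (fun u => by
      have hu := h ![1, u]
      simp only [Qform, normSqC, Fin.sum_univ_two, Matrix.cons_val_zero, Matrix.cons_val_one,
        map_one] at hu
      linear_combination hu)
  refine ⟨?_, ?_, ?_⟩ <;> apply mul_left_cancel₀ hβ'
  · linear_combination h02
  · linear_combination h12 - h01
  · linear_combination h00 + h22 - h11
end

section
/- Fix real numbers α, β, c with β ≠ 0, and let R : Fin 2 → Fin 2 → Fin 2 → Fin 2 → ℂ satisfy the Hermitian symmetry R i j k l = conj (R j i l k) and the constant fourth mixed curvature condition C^{(4)}_{α,β} = c: for every X : Fin 2 → ℂ, (α:ℂ) * (∑_{i,j} Ric⁴ i j * X i * conj (X j)) * ‖X‖² + (β:ℂ) * Q(X) = (c:ℂ) * (‖X‖²)². Then (i) R 1 2 1 2 = 0; (ii) R 1 2 2 2 + R 2 2 1 2 − R 1 2 1 1 − R 1 1 1 2 = 0; and (iii) R 1 1 1 1 + R 2 2 2 2 − R 1 1 2 2 − R 2 2 1 1 − R 1 2 2 1 − R 2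 1 1 2 = 0. -/
open ComplexConjugate

/-- A polynomial of bidegree at most `(2, 2)` in `w` and `conj w` that vanishes on all of `ℂ` has
vanishing diagonal coefficients, and its coefficients of `conj w`, `conj w ^ 2` and
`w * conj w ^ 2` vanish. -/
theorem coeffs_eq_zero_of_forall_conj_polynomial_eq_zero
    {a₀₀ a₁₀ a₀₁ a₂₀ a₁₁ a₀₂ a₂₁ a₁₂ a₂₂ : ℂ}
    (h : ∀ w : ℂ, a₀₀ + a₁₀ * w + a₀₁ * conj w + a₂₀ * w ^ 2 + a₁₁ * (w * conj w)
      + a₀₂ * conj w ^ 2 + a₂₁ * (w ^ 2 * conj w) + a₁₂ * (w * conj w ^ 2)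
      + a₂₂ * (w ^ 2 * conj w ^ 2) = 0) :
    a₀₀ = 0 ∧ a₁₁ = 0 ∧ a₂₂ = 0 ∧ a₀₁ = 0 ∧ a₁₂ = 0 ∧ a₀₂ = 0 := by
  have hI : Complex.I ^ 2 = -1 := Complex.I_sq
  have hI3 : Complex.I ^ 3 = -Complex.I := Complex.I_pow_three
  have hI4 : Complex.I ^ 4 = 1 := Complex.I_pow_four
  have h0 : a₀₀ = 0 := by simpa using h 0
  have p1 := h 1
  have m1 := h (-1)
  have p2 := h 2
  have m2 := h (-2)
  have pI := h Complex.I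
  have mI := h (-Complex.I)
  have p2I := h (2 * Complex.I)
  have m2I := h (-(2 * Complex.I))
  have pd := h (1 + Complex.I)
  have md := h (-(1 + Complex.I))
  simp only [map_neg, map_one, map_mul, map_add, Complex.conj_I, map_ofNat]
    at p1 m1 p2 m2 pI mI p2I m2I pd md
  ring_nf at p1 m1 p2 m2 pI mI p2I m2I pd md
  simp only [hI, hI3, hI4] at pI mI p2I m2I pd md
  have s1 : a₀₀ + a₁₁ + a₂₂ = 0 := by linear_combination (p1 + m1 + pI + mI) / 4
  have s2 : a₀₀ + 4 * a₁₁ + 16 * a₂₂ = 0 := by linear_combination (p2 + m2 + p2I + m2I) / 4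
  have h11 : a₁₁ = 0 := by linear_combination (16 * s1 - s2 - 15 * h0) / 12
  have h22 : a₂₂ = 0 := by linear_combination (s2 - 4 * s1 + 3 * h0) / 12
  have e1 : a₂₀ + a₀₂ = 0 := by linear_combination (p1 + m1 - pI - mI) / 4
  have e2 : Complex.I * (a₂₀ - a₀₂) = 0 := by
    linear_combination (pd + md) / 4 - h0 / 2 - h11 - 2 * h22
  have o1 : a₁₀ + a₀₁ + (a₂₁ + a₁₂) = 0 := by linear_combination (p1 - m1) / 2
  have o2 : a₁₀ + a₀₁ + 4 * (a₂₁ + a₁₂) = 0 := by linear_combination (p2 - m2) / 4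
  have o3 : Complex.I * (a₁₀ - a₀₁ + (a₂₁ - a₁₂)) = 0 := by linear_combination (pI - mI) / 2
  have o4 : Complex.I * (a₁₀ - a₀₁ + 4 * (a₂₁ - a₁₂)) = 0 := by
    linear_combination (p2I - m2I) / 4
  have e2' := (mul_eq_zero.mp e2).resolve_left Complex.I_ne_zero
  have o3' := (mul_eq_zero.mp o3).resolve_left Complex.I_ne_zero
  have o4' := (mul_eq_zero.mp o4).resolve_left Complex.I_ne_zero
  refine ⟨h0, h11, h22, ?_, ?_, ?_⟩
  · linear_combination (4 * o1 - o2 - 4 * o3' + o4') / 6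
  · linear_combination (o2 - o1 - o4' + o3') / 6
  · linear_combination (e1 - e2') / 2

/-- Theorem 1.1 for k = fourth: a surface with constant fourth-th mixed curvature is self-dual,
i.e. W₁⁻ = W₂⁻ = W₃⁻ = 0. Paper indices 1,2 correspond to `0,1 : Fin 2`. -/
theorem constant_mixed4_selfdual (α β c : ℝ) (hβ : β ≠ 0)
    (R : Fin 2 → Fin 2 → Fin 2 → Fin 2 → ℂ)
    (hherm : ∀ i j k l : Fin 2, R i j k l = conj (R j i l k))
    (h : ∀ X : Fin 2 → ℂ,
      (α : ℂ) * (∑ i, ∑ j, ric4 R i j * X i * conj (X j)) * normSqC X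
        + (β : ℂ) * Qform R X = (c : ℂ) * (normSqC X) ^ 2) :
    R 0 1 0 1 = 0
      ∧ R 0 1 1 1 + R 1 1 0 1 - R 0 1 0 0 - R 0 0 0 1 = 0
      ∧ R 0 0 0 0 + R 1 1 1 1 - R 0 0 1 1 - R 1 1 0 0 - R 0 1 1 0 - R 1 0 0 1 = 0 := by
  have hβ' : (β : ℂ) ≠ 0 := Complex.ofReal_ne_zero.mpr hβ
  obtain ⟨h00, h11, h22, h01, h12, h02⟩ :=
    coeffs_eq_zero_of_forall_conj_polynomial_eq_zero
      (a₀₀ := α * ric4 R 0 0 + β * R 0 0 0 0 - c)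
      (a₁₀ := α * ric4 R 1 0 + β * (R 0 0 1 0 + R 1 0 0 0))
      (a₀₁ := α * ric4 R 0 1 + β * (R 0 0 0 1 + R 0 1 0 0))
      (a₂₀ := β * R 1 0 1 0)
      (a₁₁ := α * (ric4 R 0 0 + ric4 R 1 1)
        + β * (R 0 0 1 1 + R 1 1 0 0 + R 0 1 1 0 + R 1 0 0 1) - 2 * c)
      (a₀₂ := β * R 0 1 0 1)
      (a₂₁ := α * ric4 R 1 0 + β * (R 1 1 1 0 + R 1 0 1 1))
      (a₁₂ := α * ric4 R 0 1 + β * (R 0 1 1 1 + R 1 1 0 1))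
      (a₂₂ := α * ric4 R 1 1 + β * R 1 1 1 1 - c) (by
        intro w
        have hw := h ![1, w]
        simp only [Qform, normSqC, Fin.sum_univ_two, Matrix.cons_val_zero, Matrix.cons_val_one,
          map_one] at hw
        linear_combination hw)
  refine ⟨(mul_eq_zero.mp h02).resolve_left hβ', mul_left_cancel₀ hβ' ?_,
    mul_left_cancel₀ hβ' ?_⟩
  · linear_combination h12 - h01
  · linear_combination h00 + h22 - h11
end

section
/- Fix n ≥ 1 and real numbers α, β, c. Let R : Fin n → Fin n → Fin n → Fin n → ℂ satisfy the constant second mixed curvature condition C^{(2)}_{α,β} = c: for every X : Fin n → ℂ, (α:ℂ) * (∑_{i,j} Ric² i j * X i * conj (X j)) * ‖X‖² + (β:ℂ) * Q(X) = (c:ℂ) * (‖X‖²)². Then ((n+1)*α + β) * u + β * v = n*(n+1)*c. -/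
open ComplexConjugate

/-- The quartic form evaluated at `X = eₐ + w e_b`, written as an iterated contraction. -/
lemma Qform_two_point {n : ℕ} (T : Fin n → Fin n → Fin n → Fin n → ℂ) (a b : Fin n) (w : ℂ) :
    Qform T (fun i => (if i = a then 1 else 0) + w * (if i = b then 1 else 0)) =
      let f := fun i j k => T i j k a + conj w * T i j k b
      let g := fun i j => f i j a + w * f i j b
      let p := fun i => g i a + conj w * g i b
      p a + w * p b := by
  set X : Fin n → ℂ := fun i => (if i = a then 1 else 0) + w * (if i = b then 1 else 0) with hX
  have h_lin (f : Fin n → ℂ) : ∑ i, f i * X i = f a + w * f b := by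
    simp [hX, mul_add, Finset.sum_add_distrib, mul_comm]
  have h_conj (f : Fin n → ℂ) : ∑ i, f i * conj (X i) = f a + conj w * f b := by
    simp [hX, mul_add, Finset.sum_add_distrib, apply_ite conj, mul_comm]
  have h_iter : Qform T X =
      ∑ i, (∑ j, (∑ k, (∑ l, T i j k l * conj (X l)) * X k) * conj (X j)) * X i := by
    simp only [Qform, Finset.sum_mul]
    refine Finset.sum_congr rfl fun i _ => Finset.sum_congr rfl fun j _ =>
      Finset.sum_congr rfl fun k _ => Finset.sum_congr rfl fun l _ => by ring
  rw [h_iter]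
  simp only [h_lin, h_conj]

/-- If the quartic form vanishes identically, so does the sum of its two full traces. -/
lemma sum_traces_eq_zero_of_Qform_eq_zero {n : ℕ} (T : Fin n → Fin n → Fin n → Fin n → ℂ)
    (hT : ∀ X, Qform T X = 0) : scalarU T + scalarV T = 0 := by
  have h_pair (a b : Fin n) : T a a a a + T b b b b + T a a b b + T a b b a + T b b a a
      + T b a a b = 0 := by
    have h1 := (Qform_two_point T a b 1).symm.trans (hT _)
    have h2 := (Qform_two_point T a b (-1)).symm.trans (hT _)
    have h3 := (Qform_two_point T a b Complex.I).symm.trans (hT _)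
    have h4 := (Qform_two_point T a b (-Complex.I)).symm.trans (hT _)
    simp only [map_one, map_neg, Complex.conj_I] at h1 h2 h3 h4
    have hI := Complex.I_sq
    have hI4 : Complex.I ^ 4 = 1 := Complex.I_pow_four
    ring_nf at h1 h2 h3 h4
    simp only [hI, hI4] at h3 h4
    linear_combination (h1 + h2 + h3 + h4) / 4
  have h_diag (a : Fin n) : T a a a a = 0 := by
    linear_combination h_pair a a / 6
  have h_sum : ∑ a, ∑ b, (T a a b b + T a b b a + T b b a a + T b a a b) = 0 :=
    Finset.sum_eq_zero fun a _ => Finset.sum_eq_zero fun b _ => by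
      linear_combination h_pair a b - h_diag a - h_diag b
  simp only [Finset.sum_add_distrib] at h_sum
  rw [Finset.sum_comm (f := fun a b => T b b a a),
    Finset.sum_comm (f := fun a b => T b a a b)] at h_sum
  unfold scalarU scalarV
  linear_combination h_sum / 2

/-- Averaged scalar identity for k = 2: `((n+1)α + β) u + β v = n(n+1) c`. -/
theorem constant_mixed2_scalar_identity (n : ℕ) (hn : 1 ≤ n) (α β c : ℝ)
    (R : Fin n → Fin n → Fin n → Fin n → ℂ)
    (h : ∀ X : Fin n → ℂ,
      (α : ℂ) * (∑ i, ∑ j, ric2 R i j * X i * conj (X j)) * normSqC X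
        + (β : ℂ) * Qform R X = (c : ℂ) * (normSqC X) ^ 2) :
    ((((n : ℝ) + 1) * α + β : ℝ) : ℂ) * scalarU R + (β : ℂ) * scalarV R
      = (((n : ℝ) * ((n : ℝ) + 1) * c : ℝ) : ℂ) := by
  let T : Fin n → Fin n → Fin n → Fin n → ℂ := fun i j k l =>
    α * (ric2 R i j * kdelta k l) + β * R i j k l - c * (kdelta i j * kdelta k l)
  have h_norm (X : Fin n → ℂ) : normSqC X = ∑ k, ∑ l, kdelta k l * X k * conj (X l) := by
    simp [normSqC, kdelta]
  have h_prod (A B : Fin n → Fin n → ℂ) (X : Fin n → ℂ) :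
      Qform (fun i j k l => A i j * B k l) X =
        (∑ i, ∑ j, A i j * X i * conj (X j)) * ∑ k, ∑ l, B k l * X k * conj (X l) := by
    simp only [Qform, Finset.sum_mul]
    refine Finset.sum_congr rfl fun i _ => Finset.sum_congr rfl fun j _ => ?_
    simp only [Finset.mul_sum]
    exact Finset.sum_congr rfl fun k _ => Finset.sum_congr rfl fun l _ => by ring
  have hT (X : Fin n → ℂ) : Qform T X = 0 := by
    have h_split : Qform T X = α * Qform (fun i j k l => ric2 R i j * kdelta k l) X
        + β * Qform R X - c * Qform (fun i j k l => kdelta i j * kdelta k l) X := by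
      simp only [Qform, T, Finset.mul_sum, ← Finset.sum_add_distrib, ← Finset.sum_sub_distrib]
      exact Finset.sum_congr rfl fun i _ => Finset.sum_congr rfl fun j _ =>
        Finset.sum_congr rfl fun k _ => Finset.sum_congr rfl fun l _ => by ring
    rw [h_split, h_prod, h_prod, ← h_norm]
    linear_combination h X
  have h_ric : ∑ i, ric2 R i i = scalarU R := Finset.sum_comm
  have hU : scalarU T = n * α * scalarU R + β * scalarU R - c * n ^ 2 := by
    rw [show scalarU T = ∑ i, ∑ k, T i i k k from rfl]
    simp [T, kdelta, Finset.sum_add_distrib, Finset.sum_sub_distrib, ← Finset.mul_sum,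
      h_ric]
    rw [← scalarU]
    ring
  have hV : scalarV T = α * scalarU R + β * scalarV R - c * n := by
    rw [← h_ric]
    simp [T, scalarV, kdelta, Finset.sum_add_distrib, Finset.sum_sub_distrib, ← Finset.mul_sum]
    ring
  have h_zero := sum_traces_eq_zero_of_Qform_eq_zero T hT
  rw [hU, hV] at h_zero
  push_cast
  linear_combination h_zero
end

section
/- Fix n ≥ 1 and real numbers α, β with β ≠ 0 and (n+1)*α + 2*β = 0. Let R : Fin n → Fin n → Fin n → Fin n → ℂ satisfy the vanishing second mixed curvature condition C^{(2)}_{α,β} = 0: for every X : Fin n → ℂ, (α:ℂ) * (∑_{i,j} Ric² i j * X i * conj (X j)) * ‖X‖² + (β:ℂ) * Q(X) = 0. Then u = v, i.e. ∑_{i,k} R i i k k = ∑_{i,k} R i k k i. -/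
open ComplexConjugate

lemma sum_mul_single_add_smul_single {n : ℕ} (f : Fin n → ℂ) (i k : Fin n) (z : ℂ) :
    ∑ a, f a * (Pi.single i 1 + z • Pi.single k 1 : Fin n → ℂ) a = f i + z * f k := by
  simp [mul_add, Finset.sum_add_distrib, Pi.single_apply, mul_comm]

lemma sum_mul_conj_single_add_smul_single {n : ℕ} (f : Fin n → ℂ) (i k : Fin n) (z : ℂ) :
    ∑ a, f a * conj ((Pi.single i 1 + z • Pi.single k 1 : Fin n → ℂ) a) =
      f i + conj z * f k := by
  have hconj (a c : Fin n) : conj ((Pi.single c 1 : Fin n → ℂ) a) =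
      (Pi.single c 1 : Fin n → ℂ) a := by
    rw [Pi.single_apply]
    split_ifs <;> simp
  simpa [hconj] using sum_mul_single_add_smul_single f i k (conj z)

lemma Qform_eq_iterated_sum {n : ℕ} (T : Fin n → Fin n → Fin n → Fin n → ℂ) (X : Fin n → ℂ) :
    Qform T X =
      ∑ i, (∑ j, (∑ k, (∑ l, T i j k l * conj (X l)) * X k) * conj (X j)) * X i := by
  simp only [Qform, Finset.sum_mul]
  refine Finset.sum_congr rfl fun i _ => Finset.sum_congr rfl fun j _ =>
    Finset.sum_congr rfl fun k _ => Finset.sum_congr rfl fun l _ => ?_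
  ring

/-- Polarization on the plane spanned by two basis vectors, by averaging over fourth roots of
unity. -/
lemma polarization_of_Qform_eq_zero {n : ℕ} {T : Fin n → Fin n → Fin n → Fin n → ℂ}
    (hT : ∀ X, Qform T X = 0) (i k : Fin n) :
    T i i k k + T k k i i + T i k k i + T k i i k = 0 := by
  have key (z : ℂ) := hT (Pi.single i 1 + z • Pi.single k 1)
  have diag (a : Fin n) := hT (Pi.single a 1 + (0 : ℂ) • Pi.single a 1)
  simp only [Qform_eq_iterated_sum, sum_mul_single_add_smul_single,
    sum_mul_conj_single_add_smul_single] at key diag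
  have h1 := key 1
  have h2 := key (-1)
  have h3 := key Complex.I
  have h4 := key (-Complex.I)
  have hi := diag i
  have hk := diag k
  simp only [map_one, map_neg, map_zero, Complex.conj_I] at h1 h2 h3 h4 hi hk
  ring_nf at h1 h2 h3 h4 hi hk
  simp only [Complex.I_sq, Complex.I_pow_three, Complex.I_pow_four] at h3 h4
  linear_combination (h1 + h2 + h3 + h4) / 4 - hi - hk

lemma scalarU_add_scalarV_eq_zero {n : ℕ} {T : Fin n → Fin n → Fin n → Fin n → ℂ}
    (hT : ∀ X, Qform T X = 0) : scalarU T + scalarV T = 0 := by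
  have hsum : ∑ i, ∑ k, (T i i k k + T k k i i + T i k k i + T k i i k) = 0 :=
    Finset.sum_eq_zero fun i _ => Finset.sum_eq_zero fun k _ =>
      polarization_of_Qform_eq_zero hT i k
  simp only [Finset.sum_add_distrib] at hsum
  rw [Finset.sum_comm (f := fun i k => T k k i i),
    Finset.sum_comm (f := fun i k => T k i i k)] at hsum
  unfold scalarU scalarV
  linear_combination hsum / 2

lemma Qform_mixed {n : ℕ} (a b : ℂ) (A : Fin n → Fin n → ℂ)
    (R : Fin n → Fin n → Fin n → Fin n → ℂ) (X : Fin n → ℂ) :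
    Qform (fun i j k l => a * (A i j * kdelta k l) + b * R i j k l) X =
      a * (∑ i, ∑ j, A i j * X i * conj (X j)) * normSqC X + b * Qform R X := by
  have hA : ∀ i j, ∑ k, ∑ l, a * (A i j * kdelta k l) * X i * conj (X j) * X k * conj (X l) =
      a * (A i j * X i * conj (X j)) * normSqC X := by
    intro i j
    simp only [kdelta, normSqC, Finset.mul_sum]
    refine Finset.sum_congr rfl fun k _ => ?_
    rw [Finset.sum_eq_single k (fun l _ hl => by simp [hl.symm]) (by simp)]
    simp only [if_true]
    ring
  simp only [Qform, add_mul, Finset.sum_add_distrib, hA]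
  simp only [Finset.mul_sum, Finset.sum_mul, mul_assoc]

/-- Pointwise core of Theorem 1.3: if `C^{(2)}_{α,β} = 0` and `(n+1)α + 2β = 0`, then `u = v`. -/
theorem vanishing_mixed2_u_eq_v (n : ℕ) (hn : 1 ≤ n) (α β : ℝ) (hβ : β ≠ 0)
    (hab : ((n : ℝ) + 1) * α + 2 * β = 0)
    (R : Fin n → Fin n → Fin n → Fin n → ℂ)
    (h : ∀ X : Fin n → ℂ,
      (α : ℂ) * (∑ i, ∑ j, ric2 R i j * X i * conj (X j)) * normSqC X
        + (β : ℂ) * Qform R X = 0) :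
    scalarU R = scalarV R := by
  have hT := scalarU_add_scalarV_eq_zero fun X =>
    (Qform_mixed (α : ℂ) (β : ℂ) (ric2 R) R X).trans (h X)
  have htr : ∑ i, ric2 R i i = scalarU R := Finset.sum_comm
  have hU : scalarU (fun i j k l => (α : ℂ) * (ric2 R i j * kdelta k l) + β * R i j k l) =
      α * (n * scalarU R) + β * scalarU R := by
    rw [← htr]
    simp only [scalarU, kdelta, Finset.sum_add_distrib, ← Finset.mul_sum]
    simp [← Finset.sum_mul, mul_comm, htr, scalarU]
  have hV : scalarV (fun i j k l => (α : ℂ) * (ric2 R i j * kdelta k l) + β * R i j k l) =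
      α * scalarU R + β * scalarV R := by
    rw [← htr]
    simp [scalarV, kdelta, Finset.sum_add_distrib, ← Finset.mul_sum]
  rw [hU, hV] at hT
  have hab' : ((n : ℂ) + 1) * α + 2 * β = 0 := by exact_mod_cast hab
  have hβ' : (β : ℂ) ≠ 0 := by exact_mod_cast hβ
  refine mul_left_cancel₀ hβ' ?_
  linear_combination scalarU R * hab' - hT
end

section
/- Fix real numbers α, β, c and let R : Fin 2 → Fin 2 → Fin 2 → Fin 2 → ℂ satisfy the constant second mixed curvature condition C^{(2)}_{α,β} = c: for every X : Fin 2 → ℂ, (α:ℂ) * (∑_{i,j} Ric² i j * X i * conj (X j)) * ‖X‖² + (β:ℂ) * Q(X) = (c:ℂ) * (‖X‖²)². Then for all indices k, l: 2*α * Ric² k l + β * (Ric³ k l + Ric⁴ k l) = (α*u + β*v) * δ_{kl}. -/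
open ComplexConjugate

/-- Equation (3.22): `2α ρ⁽²⁾ + β(ρ⁽³⁾ + ρ⁽⁴⁾) = (α u + β v) g` on a surface with constant
second mixed curvature. -/
theorem constant_mixed2_ricci_combination (α β c : ℝ)
    (R : Fin 2 → Fin 2 → Fin 2 → Fin 2 → ℂ)
    (h : ∀ X : Fin 2 → ℂ,
      (α : ℂ) * (∑ i, ∑ j, ric2 R i j * X i * conj (X j)) * normSqC X
        + (β : ℂ) * Qform R X = (c : ℂ) * (normSqC X) ^ 2) :
    ∀ k l : Fin 2,
      2 * (α : ℂ) * ric2 R k l + (β : ℂ) * (ric3 R k l + ric4 R k l)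
        = ((α : ℂ) * scalarU R + (β : ℂ) * scalarV R) * kdelta k l := by
  have e₀ := h ![1, 0]
  have e₁ := h ![0, 1]
  have p := h ![1, 1]
  have m := h ![1, -1]
  have pI := h ![1, Complex.I]
  have mI := h ![1, -Complex.I]
  simp only [ric2, Qform, normSqC, Fin.sum_univ_two, Matrix.cons_val_zero, Matrix.cons_val_one,
    map_one, map_zero, map_neg, Complex.conj_I] at e₀ e₁ p m pI mI
  intro k l
  fin_cases k <;> fin_cases l <;>
    simp [ric2, ric3, ric4, scalarU, scalarV, kdelta, Fin.sum_univ_two]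
  · linear_combination e₀ - e₁
  · linear_combination (norm := skip) (p - m + Complex.I * (pI - mI)) / 4
    ring_nf
    simp only [Complex.I_sq, Complex.I_pow_four]
    ring
  · linear_combination (norm := skip) (p - m - Complex.I * (pI - mI)) / 4
    ring_nf
    simp only [Complex.I_sq, Complex.I_pow_four]
    ring
  · linear_combination e₁ - e₀
end
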